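/- Let f and ν be a frontal with unit normal near p = (0,0) as in the context, with f_u(0,0) = 0, f_uu(0,0) ≠ 0, f_u(u,0) ≠ 0 for all u ≠ 0 near 0, and the u-axis contained in the singular set. Set γ̂(u) := f(u,0), let t(u) := ∫₀ᵘ ‖f_u(w,0)‖ dw be the arclength of γ̂, and for u ≠ 0 let |κ_s(u)| := |det(γ̂'(u), γ̂''(u), ν(u,0))|/‖γ̂'(u)‖³ be the unsigned singular curvature. Then the limiting singular curvature satisfies τ_s := 2√2 · lim_{u→0} √|t(u)| · |κ_s(u)| = |det(γ̂''(0), γ̂'''(0), ν(0,0))| / ‖γ̂''(0)‖^{5/2}, where γ̂''(u) = f_uu(u,0) and γ̂'''(u) = f_uuu(u,0). -/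

import Mathlib

open scoped RealInnerProductSpace
open Filter

noncomputable section

/-- Euclidean 3-space. -/
abbrev E3 : Type := EuclideanSpace ℝ (Fin 3)

/-- Partial derivative in the first (`u`) direction. -/
def pu {E : Type*} [NormedAddCommGroup E] [NormedSpace ℝ E] (f : ℝ × ℝ → E) (q : ℝ × ℝ) : E :=
  fderiv ℝ f q (1, 0)

/-- Partial derivative in the second (`v`) direction. -/
def pv {E : Type*} [NormedAddCommGroup E] [NormedSpace ℝ E] (f : ℝ × ℝ → E) (q : ℝ × ℝ) : E :=
  fderiv ℝ f q (0, 1)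

/-- Determinant of three column vectors in `ℝ³`. -/
def det3 (a b c : E3) : ℝ :=
  Matrix.det !![a 0, b 0, c 0; a 1, b 1, c 1; a 2, b 2, c 2]

/-- Cross product in `ℝ³`. -/
def cross3 (a b : E3) : E3 :=
  (WithLp.equiv 2 (Fin 3 → ℝ)).symm
    ![a 1 * b 2 - a 2 * b 1, a 2 * b 0 - a 0 * b 2, a 0 * b 1 - a 1 * b 0]

theorem contDiff_pu {E : Type*} [NormedAddCommGroup E] [NormedSpace ℝ E] {g : ℝ × ℝ → E}
    (hg : ContDiff ℝ (⊤ : ℕ∞) g) : ContDiff ℝ (⊤ : ℕ∞) (pu g) :=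
  (hg.fderiv_right (m := (⊤ : ℕ∞)) (by simp)).clm_apply contDiff_const

theorem hasDerivAt_pu {E : Type*} [NormedAddCommGroup E] [NormedSpace ℝ E] {g : ℝ × ℝ → E}
    (hg : ContDiff ℝ (⊤ : ℕ∞) g) (u : ℝ) :
    HasDerivAt (fun w : ℝ => g (w, 0)) (pu g (u, 0)) u :=
  ((hg.differentiable (by simp)) (u, 0)).hasFDerivAt.comp_hasDerivAt u
    ((hasDerivAt_id u).prodMk (hasDerivAt_const u (0 : ℝ)))

theorem det3_eq (a b c : E3) :
    det3 a b c = a 0 * b 1 * c 2 - a 0 * c 1 * b 2 - b 0 * a 1 * c 2 + b 0 * c 1 * a 2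
      + c 0 * a 1 * b 2 - c 0 * b 1 * a 2 := by
  simp [det3, Matrix.det_fin_three]

theorem continuous_det3 : Continuous fun x : E3 × E3 × E3 => det3 x.1 x.2.1 x.2.2 := by
  simp only [det3_eq]
  fun_prop

theorem det3_smul_middle (r : ℝ) (a b c : E3) : det3 a (r • b) c = r * det3 a b c := by
  simp only [det3_eq, PiLp.smul_apply, smul_eq_mul]
  ring

theorem det3_scaled (u : ℝ) (a b c : E3) :
    det3 (u⁻¹ • a) (u⁻¹ • (b - u⁻¹ • a)) c = det3 a b c / u ^ 2 := by
  simp only [det3_eq, PiLp.smul_apply, PiLp.sub_apply, smul_eq_mul]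
  ring

theorem tendsto_inv_smul_of_hasDerivAt {E : Type*} [NormedAddCommGroup E] [NormedSpace ℝ E]
    {a : ℝ → E} {A : E} (h : HasDerivAt a A 0) :
    Tendsto (fun u : ℝ => u⁻¹ • (a u - a 0)) (nhdsWithin 0 {0}ᶜ) (nhds A) := by
  simpa using h.tendsto_slope_zero

/-- Second-order Taylor expansion at `0` of a real function vanishing there. -/
theorem tendsto_second_order {a b : ℝ → ℝ} {B : ℝ} (ha : ∀ u, HasDerivAt a (b u) u)
    (hb : HasDerivAt b B 0) (h0 : a 0 = 0) :
    Tendsto (fun u : ℝ => (a u - u * b 0) / u ^ 2) (nhdsWithin 0 {0}ᶜ) (nhds (B / 2)) := by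
  refine HasDerivAt.lhopital_zero_nhdsNE (f' := fun u => b u - b 0) (g' := fun u => 2 * u)
    ?_ ?_ ?_ ?_ ?_ ?_
  · exact Eventually.of_forall fun u =>
      (ha u).sub (by simpa using (hasDerivAt_id u).mul_const (b 0))
  · exact Eventually.of_forall fun u => by simpa using hasDerivAt_pow 2 u
  · filter_upwards [self_mem_nhdsWithin] with u hu
    simpa using hu
  · have : ContinuousAt (fun u => a u - u * b 0) 0 :=
      (ha 0).continuousAt.sub (by fun_prop)
    simpa [ContinuousAt, h0] using this.tendsto.mono_left nhdsWithin_le_nhds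
  · have : Continuous fun u : ℝ => u ^ 2 := by fun_prop
    simpa using (this.tendsto 0).mono_left nhdsWithin_le_nhds
  · refine ((tendsto_inv_smul_of_hasDerivAt hb).div_const 2).congr fun u => ?_
    simp only [smul_eq_mul]
    ring

theorem tendsto_second_order_E3 {a b : ℝ → E3} {B : E3} (ha : ∀ u, HasDerivAt a (b u) u)
    (hb : HasDerivAt b B 0) (h0 : a 0 = 0) :
    Tendsto (fun u : ℝ => u⁻¹ • (b u - u⁻¹ • a u)) (nhdsWithin 0 {0}ᶜ)
      (nhds ((1 / 2 : ℝ) • B)) := by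
  have hcoord {c : ℝ → E3} {C : E3} {u : ℝ} (h : HasDerivAt c C u) (i : Fin 3) :
      HasDerivAt (fun w => c w i) (C i) u :=
    (EuclideanSpace.proj (𝕜 := ℝ) i).hasFDerivAt.comp_hasDerivAt u h
  have key (i : Fin 3) : Tendsto (fun u : ℝ => (u⁻¹ • (b u - u⁻¹ • a u)) i)
      (nhdsWithin 0 {0}ᶜ) (nhds (((1 / 2 : ℝ) • B) i)) := by
    have h1 := tendsto_second_order (fun u => hcoord (ha u) i) (hcoord hb i) (by simp [h0])
    have h2 := tendsto_inv_smul_of_hasDerivAt (hcoord hb i)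
    have h3 := h2.sub h1
    rw [show B i - B i / 2 = ((1 / 2 : ℝ) • B) i by simp; ring] at h3
    refine h3.congr' ?_
    filter_upwards [self_mem_nhdsWithin] with u hu
    have hu : u ≠ 0 := hu
    simp only [PiLp.smul_apply, PiLp.sub_apply, smul_eq_mul]
    field_simp
    ring
  have h := ((PiLp.continuous_toLp 2 fun _ : Fin 3 => ℝ).tendsto _).comp (tendsto_pi_nhds.2 key)
  exact h

theorem hasDerivAt_mul_abs {u : ℝ} (hu : u ≠ 0) :
    HasDerivAt (fun w : ℝ => w * |w|) (2 * |u|) u := by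
  have h := (hasDerivAt_id' u).fun_mul (hasDerivAt_abs hu)
  rwa [mul_comm u, sign_mul_self, one_mul, ← two_mul] at h

/-- Arclength of a curve whose velocity `a` vanishes to first order. -/
theorem tendsto_arclength {E : Type*} [NormedAddCommGroup E] [NormedSpace ℝ E]
    {a : ℝ → E} {A : E} (hc : Continuous a) (ha : HasDerivAt a A 0) (h0 : a 0 = 0) :
    Tendsto (fun u : ℝ => |∫ w in (0 : ℝ)..u, ‖a w‖| / u ^ 2) (nhdsWithin 0 {0}ᶜ)
      (nhds (‖A‖ / 2)) := by
  have hd (u : ℝ) : HasDerivAt (fun u : ℝ => ∫ w in (0 : ℝ)..u, ‖a w‖) ‖a u‖ u :=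
    intervalIntegral.integral_hasDerivAt_right (hc.norm.intervalIntegrable _ _)
      (hc.norm.stronglyMeasurableAtFilter _ _) hc.norm.continuousAt
  have h : Tendsto (fun u : ℝ => (∫ w in (0 : ℝ)..u, ‖a w‖) / (u * |u|)) (nhdsWithin 0 {0}ᶜ)
      (nhds (‖A‖ / 2)) := by
    refine HasDerivAt.lhopital_zero_nhdsNE (f' := fun u => ‖a u‖) (g' := fun u => 2 * |u|)
      (Eventually.of_forall hd) ?_ ?_ ?_ ?_ ?_
    · filter_upwards [self_mem_nhdsWithin] with u hu using hasDerivAt_mul_abs hu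
    · filter_upwards [self_mem_nhdsWithin] with u hu
      simpa using hu
    · simpa [ContinuousAt] using (hd 0).continuousAt.tendsto.mono_left nhdsWithin_le_nhds
    · have : Continuous fun u : ℝ => u * |u| := by fun_prop
      simpa using (this.tendsto 0).mono_left nhdsWithin_le_nhds
    · refine ((tendsto_inv_smul_of_hasDerivAt ha).norm.div_const 2).congr fun u => ?_
      rw [h0, sub_zero, norm_smul, norm_inv, Real.norm_eq_abs]
      ring
  have h' := h.abs
  rw [abs_of_nonneg (by positivity : 0 ≤ ‖A‖ / 2)] at h'
  refine h'.congr fun u => ?_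
  rw [abs_div, abs_mul, abs_abs, ← sq, sq_abs]

theorem limiting_constant {r D : ℝ} (hr : 0 < r) :
    2 * Real.sqrt 2 * (Real.sqrt (r / 2) * (|1 / 2 * D| / r ^ 3)) = |D| / r ^ ((5 : ℝ) / 2) := by
  have h2 : Real.sqrt 2 * Real.sqrt (r / 2) = Real.sqrt r := by
    rw [← Real.sqrt_mul (by norm_num)]
    congr 1
    ring
  have h3 : r ^ 3 = Real.sqrt r * r ^ ((5 : ℝ) / 2) := by
    rw [Real.sqrt_eq_rpow, ← Real.rpow_add hr, ← Real.rpow_natCast]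
    norm_num
  have hs : 0 < Real.sqrt r := Real.sqrt_pos.2 hr
  have hp : 0 < r ^ ((5 : ℝ) / 2) := Real.rpow_pos_of_pos hr _
  rw [abs_mul, abs_of_pos (by norm_num : (0 : ℝ) < 1 / 2)]
  calc 2 * Real.sqrt 2 * (Real.sqrt (r / 2) * (1 / 2 * |D| / r ^ 3))
      = Real.sqrt 2 * Real.sqrt (r / 2) * |D| / r ^ 3 := by ring
    _ = |D| / r ^ ((5 : ℝ) / 2) := by
        rw [h2, h3]
        field_simp

/-- **Limiting singular curvature at a swallowtail.** If `f_u(0,0) = 0`, `f_uu(0,0) ≠ 0`,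
`f_u(u,0) ≠ 0` for small `u ≠ 0` and the `u`-axis consists of singular points, then with
`t(u) = ∫₀ᵘ ‖f_u(w,0)‖ dw` and the unsigned singular curvature
`|κ_s(u)| = |det(γ̂', γ̂'', ν)|/‖γ̂'‖³` (`γ̂(u) = f(u,0)`, so `γ̂' = f_u`, `γ̂'' = f_uu`),
`2√2·√|t(u)|·|κ_s(u)| → |det(f_uu, f_uuu, ν)(0,0)| / ‖f_uu(0,0)‖^{5/2}` as `u → 0`. -/
theorem limiting_singular_curvature_at_swallowtail
    (f ν : ℝ × ℝ → E3)
    (hf : ContDiff ℝ (⊤ : ℕ∞) f) (hν : ContDiff ℝ (⊤ : ℕ∞) ν)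
    (hfrontal : ∀ᶠ q in nhds ((0, 0) : ℝ × ℝ),
      ‖ν q‖ = 1 ∧ ⟪ν q, pu f q⟫ = 0 ∧ ⟪ν q, pv f q⟫ = 0)
    (hfu0 : pu f (0, 0) = 0) (hfuu : pu (pu f) (0, 0) ≠ 0)
    (hfune : ∀ᶠ u in nhdsWithin (0 : ℝ) {0}ᶜ, pu f (u, 0) ≠ 0)
    (hsing : ∀ᶠ u in nhds (0 : ℝ), ¬ LinearIndependent ℝ ![pu f (u, 0), pv f (u, 0)]) :
    Tendsto (fun u : ℝ =>
        2 * Real.sqrt 2 *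
          (Real.sqrt |∫ w in (0 : ℝ)..u, ‖pu f (w, 0)‖| *
            (|det3 (pu f (u, 0)) (pu (pu f) (u, 0)) (ν (u, 0))| / ‖pu f (u, 0)‖ ^ 3)))
      (nhdsWithin 0 {0}ᶜ)
      (nhds (|det3 (pu (pu f) (0, 0)) (pu (pu (pu f)) (0, 0)) (ν (0, 0))| /
        ‖pu (pu f) (0, 0)‖ ^ ((5 : ℝ) / 2))) := by
  have ha (u : ℝ) := hasDerivAt_pu (contDiff_pu hf) u
  have hb := hasDerivAt_pu (contDiff_pu (contDiff_pu hf)) 0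
  have hac : Continuous fun u : ℝ => pu f (u, 0) :=
    continuous_iff_continuousAt.2 fun u => (ha u).continuousAt
  have ht := tendsto_arclength hac (ha 0) hfu0
  have hp := tendsto_inv_smul_of_hasDerivAt (ha 0)
  simp only [hfu0, sub_zero] at hp
  have hq := tendsto_second_order_E3 ha hb hfu0
  have hn : Tendsto (fun u : ℝ => ν (u, 0)) (nhdsWithin 0 {0}ᶜ) (nhds (ν (0, 0))) :=
    (hasDerivAt_pu hν 0).continuousAt.tendsto.mono_left nhdsWithin_le_nhds
  have hdet := (continuous_det3.tendsto _).comp (hp.prodMk_nhds (hq.prodMk_nhds hn))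
  have hA : 0 < ‖pu (pu f) (0, 0)‖ := norm_pos_iff.2 hfuu
  have hlim := (ht.sqrt.mul (hdet.abs.div (hp.norm.pow 3) (pow_ne_zero 3 hA.ne'))).const_mul
    (2 * Real.sqrt 2)
  rw [det3_smul_middle, limiting_constant hA] at hlim
  refine hlim.congr' ?_
  filter_upwards [self_mem_nhdsWithin] with u hu
  have hu : |u| ≠ 0 := abs_ne_zero.2 hu
  simp only [Function.comp_apply, Pi.div_apply]
  rw [det3_scaled, Real.sqrt_div (abs_nonneg _), Real.sqrt_sq_eq_abs, norm_smul, norm_inv,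
    Real.norm_eq_abs, abs_div, abs_pow, mul_pow, inv_pow]
  congr 1
  field_simp
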